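/- arXiv:1808.01692 — 2 statements merged into one kernel-verified Lean document; each statement's English description precedes it below -/
import Mathlib

section
/- Let k, ℓ ≥ 1 and d = k + ℓ. Index rows by Fin (k+1) ⊕ Fin (ℓ+1) (so v = k+ℓ+2) and columns by Fin (k+1) × Fin (ℓ+1) (so f = (k+1)(ℓ+1)), and let E be the vertex-edge incidence support of the complete bipartite graph K_{k+1,ℓ+1}: (Sum.inl a, (a',b)) ∈ E iff a = a', and (Sum.inr b, (a',b')) ∈ E iff b = b'. (This is the zero pattern of the slack matrix of the free sum of simplices Δ_k ⊕ Δ_ℓ, a d-polytope with d+2 vertices.) Then the slack-type ideal equals the toric ideal of the bipartite non-incidence graph: I(E,d) = T(E). -/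
open MvPolynomial

open Classical in
/-- The symbolic slack matrix of a support pattern `E`. -/
noncomputable def symbMat {V F : Type} (E : Set (V × F)) :
    Matrix V F (MvPolynomial E ℂ) :=
  fun i j => if h : (i, j) ∈ E then X (⟨(i, j), h⟩ : E) else 0

/-- The ideal of `(d+2)`-minors of the symbolic slack matrix. -/
noncomputable def minorIdeal {V F : Type} (E : Set (V × F)) (d : ℕ) :
    Ideal (MvPolynomial E ℂ) :=
  Ideal.span {p | ∃ (ρ : Fin (d + 2) → V) (σ : Fin (d + 2) → F),
    Function.Injective ρ ∧ Function.Injective σ ∧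
    p = ((symbMat E).submatrix ρ σ).det}

/-- The slack-type ideal: saturation of the minor ideal by the product of all variables. -/
noncomputable def slackIdeal {V F : Type} (E : Set (V × F)) (d : ℕ) :
    Ideal (MvPolynomial E ℂ) where
  carrier := {p | ∃ k : ℕ, (∏ᶠ e : E, X e) ^ k * p ∈ minorIdeal E d}
  zero_mem' := ⟨0, by simp⟩
  add_mem' := by
    rintro p q ⟨k₁, h₁⟩ ⟨k₂, h₂⟩
    refine ⟨k₁ + k₂, ?_⟩
    have heq : (∏ᶠ e : E, (X e : MvPolynomial E ℂ)) ^ (k₁ + k₂) * (p + q) =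
        (∏ᶠ e : E, (X e : MvPolynomial E ℂ)) ^ k₂ * ((∏ᶠ e : E, (X e : MvPolynomial E ℂ)) ^ k₁ * p) +
        (∏ᶠ e : E, (X e : MvPolynomial E ℂ)) ^ k₁ * ((∏ᶠ e : E, (X e : MvPolynomial E ℂ)) ^ k₂ * q) := by
      ring
    rw [heq]
    exact Ideal.add_mem _ (Ideal.mul_mem_left _ _ h₁) (Ideal.mul_mem_left _ _ h₂)
  smul_mem' := by
    rintro a p ⟨k, h⟩
    refine ⟨k, ?_⟩
    have heq : (∏ᶠ e : E, (X e : MvPolynomial E ℂ)) ^ k * (a • p) =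
        a * ((∏ᶠ e : E, (X e : MvPolynomial E ℂ)) ^ k * p) := by
      rw [smul_eq_mul]; ring
    rw [heq]
    exact Ideal.mul_mem_left _ _ h

/-- The algebra map sending `x_{(i,j)} ↦ y_i z_j`, whose kernel is the toric ideal of the
bipartite non-incidence graph. -/
noncomputable def piE {V F : Type} (E : Set (V × F)) :
    MvPolynomial E ℂ →ₐ[ℂ] MvPolynomial (V ⊕ F) ℂ :=
  aeval fun e => X (Sum.inl e.1.1) * X (Sum.inr e.1.2)

/-- Determinant of a matrix that is triangular for an injective ranking of the indices. -/
theorem det_of_rank {V A : Type} [Fintype V] [DecidableEq V] [CommRing A]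
    (N : Matrix V V A) (f : V → ℕ) (hf : Function.Injective f)
    (h : ∀ i j, f j < f i → N i j = 0) : N.det = ∏ i, N i i := by
  let : LinearOrder V := LinearOrder.lift' f hf
  have h2 : N.BlockTriangular id := fun i j hij => h i j hij
  convert Matrix.det_of_isUpperTriangular h2

/-- The matrix with two-entry columns indexed by edges of the complete bipartite graph. -/
def incM {k l : ℕ} {A : Type} [CommRing A] (U W : Fin (k + 1) → Fin (l + 1) → A) :
    Matrix (Fin (k + 1) ⊕ Fin (l + 1)) (Fin (k + 1) × Fin (l + 1)) A :=
  fun i j => Sum.elim (fun a => if j.1 = a then U j.1 j.2 else 0)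
    (fun b => if j.2 = b then W j.1 j.2 else 0) i

theorem four_cycle {k l : ℕ} {A : Type} [CommRing A]
    (U U' W W' : Fin (k + 1) → Fin (l + 1) → A)
    (hU : ∀ a b, U a b * U' a b = 1) (hW : ∀ a b, W a b * W' a b = 1)
    (hdet : ∀ σ : Fin (k + 1) ⊕ Fin (l + 1) → Fin (k + 1) × Fin (l + 1),
      Function.Injective σ → ((incM U W).submatrix id σ).det = 0) (a : Fin (k + 1))
    (b : Fin (l + 1)) :
    U 0 0 * W a 0 * U a b * W 0 b = U 0 b * W a b * W 0 0 * U a 0 := by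
  by_cases ha : a = 0
  · subst ha; ring
  by_cases hb : b = 0
  · subst hb; ring
  let σ : Fin (k + 1) ⊕ Fin (l + 1) → Fin (k + 1) × Fin (l + 1) :=
    Sum.elim (fun a' => if a' = 0 then (a, b) else (a', 0)) (fun b' => (0, b'))
  have hσ : Function.Injective σ := by
    rintro (x | x) (y | y) h <;> simp only [σ, Sum.elim_inl, Sum.elim_inr] at h <;>
      (try split_ifs at h) <;> simp_all
  have hσ0 : σ (Sum.inl 0) = (a, b) := by simp [σ]
  have hσ1 : ∀ x, x ≠ 0 → σ (Sum.inl x) = (x, 0) := fun x hx => if_neg hx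
  have hσ2 : ∀ x, σ (Sum.inr x) = (0, x) := fun x => rfl
  have hd := hdet σ hσ
  set M := (incM U W).submatrix id σ with hM
  have hMl : ∀ x j, M (Sum.inl x) j = if (σ j).1 = x then U (σ j).1 (σ j).2 else 0 :=
    fun x j => rfl
  have hMr : ∀ x j, M (Sum.inr x) j = if (σ j).2 = x then W (σ j).1 (σ j).2 else 0 :=
    fun x j => rfl
  let c : Fin (k + 1) ⊕ Fin (l + 1) → A :=
    Sum.elim (fun a' => U 0 0 * W a' 0 * W' 0 0 * U' a' 0) (fun b' => - (U 0 b' * W' 0 b'))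
  have h1 := Matrix.det_updateRow_sum M (Sum.inl 0) c
  rw [hd, smul_zero] at h1
  set N := M.updateRow (Sum.inl 0) (∑ i, c i • M i) with hN
  let δ : A := U 0 0 * W a 0 * W' 0 0 * U' a 0 * U a b - U 0 b * W' 0 b * W a b
  have hroot : ∀ j, N (Sum.inl 0) j = if j = Sum.inl 0 then δ else 0 := by
    intro j
    have hs : N (Sum.inl 0) j = c (Sum.inl (σ j).1) * U (σ j).1 (σ j).2
        + c (Sum.inr (σ j).2) * W (σ j).1 (σ j).2 := by
      have h0 : N (Sum.inl 0) j = ∑ i, c i * M i j := by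
        rw [hN, Matrix.updateRow_self]
        exact Finset.sum_apply j Finset.univ (fun i => c i • M i)
      rw [h0, Fintype.sum_sum_type]
      simp only [hMl, hMr, mul_ite, mul_zero, Finset.sum_ite_eq, Finset.mem_univ, if_true]
    rw [hs]
    rcases j with x | x
    · by_cases hx : x = 0
      · subst hx
        rw [hσ0, if_pos rfl]
        simp only [c, δ, Sum.elim_inl, Sum.elim_inr]
        ring
      · rw [hσ1 x hx, if_neg (by simpa using hx)]
        simp only [c, Sum.elim_inl, Sum.elim_inr]
        linear_combination (U 0 0 * W x 0 * W' 0 0) * hU x 0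
    · rw [hσ2, if_neg (by simp)]
      simp only [c, Sum.elim_inl, Sum.elim_inr]
      linear_combination (U 0 x * W 0 0 * W' 0 0) * hU 0 0 + U 0 x * hW 0 0 - U 0 x * hW 0 x
  have hother : ∀ i j, i ≠ Sum.inl 0 → N i j = M i j := by
    intro i j hi
    simp [hN, Matrix.updateRow_ne hi]
  let f : Fin (k + 1) ⊕ Fin (l + 1) → ℕ :=
    Sum.elim (fun a' => l + 1 + (k + 1 - a')) (fun b' => b')
  have hf : Function.Injective f := by
    rintro (x | x) (y | y) h <;> simp only [f, Sum.elim_inl, Sum.elim_inr] at h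
    · congr 1; ext; omega
    · omega
    · omega
    · congr 1; ext; omega
  have htri : ∀ i j, f j < f i → N i j = 0 := by
    intro i j hij
    by_cases hi : i = Sum.inl 0
    · subst hi
      rw [hroot, if_neg]
      rintro rfl
      exact lt_irrefl _ hij
    rw [hother i j hi]
    rcases i with x | x <;> rcases j with y | y <;>
      simp only [f, Sum.elim_inl, Sum.elim_inr] at hij
    · have hy : y ≠ 0 := by rintro rfl; simp at hij; omega
      rw [hMl, hσ1 y hy, if_neg]
      rintro h; simp only at h; subst h; exact lt_irrefl _ hij
    · rw [hMl, hσ2, if_neg]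
      rintro rfl; exact hi rfl
    · omega
    · rw [hMr, hσ2, if_neg]
      rintro rfl; exact lt_irrefl _ hij
  rw [det_of_rank N f hf htri, Fintype.prod_sum_type, Fin.prod_univ_succ, hroot, if_pos rfl] at h1
  have hx : ∀ x : Fin k, N (Sum.inl x.succ) (Sum.inl x.succ) = U x.succ 0 := by
    intro x
    rw [hother _ _ (by simp), hMl, hσ1 _ (Fin.succ_ne_zero x), if_pos rfl]
  have hy : ∀ x : Fin (l + 1), N (Sum.inr x) (Sum.inr x) = W 0 x := by
    intro x
    rw [hother _ _ (by simp), hMr, hσ2, if_pos rfl]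
  simp only [hx, hy] at h1
  have e1 : (∏ x : Fin k, U x.succ 0) * (∏ x : Fin k, U' x.succ 0) = 1 := by
    rw [← Finset.prod_mul_distrib]; simp [hU]
  have e2 : (∏ x, W 0 x) * (∏ x, W' 0 x) = 1 := by
    rw [← Finset.prod_mul_distrib]; simp [hW]
  have hδ : δ = 0 := by
    calc δ = (δ * (∏ x : Fin k, U x.succ 0) * (∏ x, W 0 x)) *
          ((∏ x : Fin k, U' x.succ 0) * (∏ x, W' 0 x)) := by
            linear_combination (- δ * ((∏ x, W 0 x) * (∏ x, W' 0 x))) * e1 - δ * e2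
      _ = 0 := by rw [h1, zero_mul]
  simp only [δ] at hδ
  linear_combination (W 0 0 * U a 0 * W 0 b) * hδ
    - (U 0 0 * W a 0 * U a b * W 0 b * U a 0 * U' a 0) * hW 0 0
    - (U 0 0 * W a 0 * U a b * W 0 b) * hU a 0
    + (U 0 b * W a b * W 0 0 * U a 0) * hW 0 b

/-- For the free sum of simplices `Δ_k ⊕ Δ_ℓ` (a `(k+ℓ)`-polytope with `k+ℓ+2` vertices and
`(k+1)(ℓ+1)` facets), whose slack matrix has the support of the vertex-edge incidence matrix
of the complete bipartite graph `K_{k+1,ℓ+1}`, the slack ideal equals the toric ideal of the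
non-incidence graph. -/
theorem stmt3 (k l : ℕ) (hk : 1 ≤ k) (hl : 1 ≤ l)
    (E : Set ((Fin (k + 1) ⊕ Fin (l + 1)) × (Fin (k + 1) × Fin (l + 1))))
    (hE : E = {p | Sum.elim (fun a => p.2.1 = a) (fun b => p.2.2 = b) p.1}) :
    slackIdeal E (k + l) = RingHom.ker (piE E) := by
  have hmem1 : ∀ a a' b, (Sum.inl a, (a', b)) ∈ E ↔ a' = a := by intros; subst hE; rfl
  have hmem2 : ∀ b a' b', (Sum.inr b, (a', b')) ∈ E ↔ b' = b := by intros; subst hE; rfl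
  clear hE
  let _ : Fintype E := Fintype.ofFinite E
  have hcard : Fintype.card (Fin (k + l + 2)) = Fintype.card (Fin (k + 1) ⊕ Fin (l + 1)) := by
    simp; omega
  apply le_antisymm
  · have hJ : minorIdeal E (k + l) ≤ RingHom.ker (piE E) := by
      rw [minorIdeal, Ideal.span_le]
      rintro p ⟨ρ, σ, hρ, -, rfl⟩
      have hbij : Function.Bijective ρ := (Fintype.bijective_iff_injective_and_card ρ).2 ⟨hρ, hcard⟩
      let y : Fin (k + l + 2) → MvPolynomial
        ((Fin (k + 1) ⊕ Fin (l + 1)) ⊕ (Fin (k + 1) × Fin (l + 1))) ℂ := fun i => X (Sum.inl (ρ i))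
      let z : Fin (k + l + 2) → MvPolynomial
        ((Fin (k + 1) ⊕ Fin (l + 1)) ⊕ (Fin (k + 1) × Fin (l + 1))) ℂ := fun i => X (Sum.inr (σ i))
      let B : Matrix (Fin (k + l + 2)) (Fin (k + l + 2)) (MvPolynomial
        ((Fin (k + 1) ⊕ Fin (l + 1)) ⊕ (Fin (k + 1) × Fin (l + 1))) ℂ) :=
          (incM (fun _ _ => 1) (fun _ _ => 1)).submatrix ρ σ
      have hB : B.det = 0 := by
        rw [← Matrix.exists_vecMul_eq_zero_iff]
        refine ⟨fun i => Sum.elim (fun _ => 1) (fun _ => -1) (ρ i), ?_, ?_⟩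
        · intro h
          obtain ⟨i, hi⟩ := hbij.2 (Sum.inl 0)
          have := congrFun h i
          simp [hi] at this
        · ext1 j
          simp only [Matrix.vecMul, dotProduct, B, Matrix.submatrix_apply, Pi.zero_apply]
          rw [hbij.sum_comp (fun v => (Sum.elim (fun _ => 1) (fun _ => -1) v : MvPolynomial
            ((Fin (k + 1) ⊕ Fin (l + 1)) ⊕ (Fin (k + 1) × Fin (l + 1))) ℂ) *
            incM (fun _ _ => 1) (fun _ _ => 1) v (σ j)), Fintype.sum_sum_type]
          simp [incM]
      have hmat : (piE E).toRingHom.mapMatrix ((symbMat E).submatrix ρ σ) =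
          Matrix.diagonal y * B * Matrix.diagonal z := by
        ext1 i j
        rw [Matrix.mul_diagonal, Matrix.diagonal_mul]
        simp only [RingHom.mapMatrix_apply, Matrix.map_apply, Matrix.submatrix_apply, symbMat, B,
          y, z]
        rcases hi : ρ i with x | x <;> rcases hj : σ j with ⟨x', y'⟩
        · by_cases h : x' = x
          · rw [dif_pos ((hmem1 _ _ _).2 h)]
            simp [piE, incM, h]
          · rw [dif_neg (fun h' => h ((hmem1 _ _ _).1 h'))]
            simp [incM, h]
        · by_cases h : y' = x
          · rw [dif_pos ((hmem2 _ _ _).2 h)]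
            simp [piE, incM, h]
          · rw [dif_neg (fun h' => h ((hmem2 _ _ _).1 h'))]
            simp [incM, h]
      show (piE E).toRingHom _ = 0
      rw [RingHom.map_det, hmat, Matrix.det_mul, Matrix.det_mul, hB]
      simp
    rintro p ⟨n, hn⟩
    have h := hJ hn
    rw [RingHom.mem_ker] at h ⊢
    rw [map_mul, map_pow] at h
    refine (mul_eq_zero.1 h).resolve_left (pow_ne_zero _ ?_)
    rw [finprod_eq_prod_of_fintype, map_prod]
    refine Finset.prod_ne_zero_iff.2 fun e _ => ?_
    simp [piE, X_ne_zero]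
  · intro p hp
    rw [RingHom.mem_ker] at hp
    let m : MvPolynomial E ℂ := ∏ᶠ e : E, X e
    let J := minorIdeal E (k + l)
    let A := Localization.Away (Ideal.Quotient.mk J m)
    let q : MvPolynomial E ℂ →ₐ[ℂ] A :=
      (IsScalarTower.toAlgHom ℂ (MvPolynomial E ℂ ⧸ J) A).comp (Ideal.Quotient.mkₐ ℂ J)
    suffices hq : q p = 0 by
      have hq' : algebraMap (MvPolynomial E ℂ ⧸ J) A (Ideal.Quotient.mk J p) = 0 := hq
      rw [IsLocalization.map_eq_zero_iff (Submonoid.powers (Ideal.Quotient.mk J m))] at hq'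
      obtain ⟨⟨_, n, rfl⟩, hn⟩ := hq'
      refine ⟨n, ?_⟩
      rw [← Ideal.Quotient.eq_zero_iff_mem, map_mul, map_pow]
      exact hn
    have hqJ : ∀ r ∈ J, q r = 0 := by
      intro r hr
      show algebraMap (MvPolynomial E ℂ ⧸ J) A (Ideal.Quotient.mk J r) = 0
      rw [Ideal.Quotient.eq_zero_iff_mem.2 hr, map_zero]
    have hunit : ∀ e : E, ∃ r : A, q (X e) * r = 1 := by
      intro e
      have hm : IsUnit (q m) := IsLocalization.Away.algebraMap_isUnit (Ideal.Quotient.mk J m)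
      have : IsUnit (q (X e)) := by
        refine isUnit_of_dvd_unit (map_dvd q ?_) hm
        simp only [m]
        rw [finprod_eq_prod_of_fintype]
        exact Finset.dvd_prod_of_mem _ (Finset.mem_univ e)
      exact this.exists_right_inv
    choose inv hinv using hunit
    let eU : Fin (k + 1) → Fin (l + 1) → E := fun a b => ⟨(Sum.inl a, (a, b)), (hmem1 _ _ _).2 rfl⟩
    let eW : Fin (k + 1) → Fin (l + 1) → E := fun a b => ⟨(Sum.inr b, (a, b)), (hmem2 _ _ _).2 rfl⟩
    let U := fun a b => q (X (eU a b))
    let U' := fun a b => inv (eU a b)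
    let W := fun a b => q (X (eW a b))
    let W' := fun a b => inv (eW a b)
    have hU : ∀ a b, U a b * U' a b = 1 := fun a b => hinv _
    have hW : ∀ a b, W a b * W' a b = 1 := fun a b => hinv _
    have hmat : (symbMat E).map q = incM U W := by
      ext1 i j
      simp only [Matrix.map_apply, symbMat]
      rcases i with x | x <;> rcases j with ⟨x', y'⟩
      · by_cases h : x' = x
        · subst h
          rw [dif_pos ((hmem1 _ _ _).2 rfl)]
          simp [incM, U, eU]
        · rw [dif_neg (fun h' => h ((hmem1 _ _ _).1 h'))]
          simp [incM, h]
      · by_cases h : y' = x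
        · subst h
          rw [dif_pos ((hmem2 _ _ _).2 rfl)]
          simp [incM, W, eW]
        · rw [dif_neg (fun h' => h ((hmem2 _ _ _).1 h'))]
          simp [incM, h]
    have hdet : ∀ σ : Fin (k + 1) ⊕ Fin (l + 1) → Fin (k + 1) × Fin (l + 1),
        Function.Injective σ → ((incM U W).submatrix id σ).det = 0 := by
      intro σ hσ
      let e := Fintype.equivOfCardEq hcard
      rw [← Matrix.det_submatrix_equiv_self e, Matrix.submatrix_submatrix, ← hmat]
      have := hqJ ((symbMat E).submatrix e (σ ∘ e)).det
        (Ideal.subset_span ⟨e, σ ∘ e, e.injective, hσ.comp e.injective, rfl⟩)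
      rw [AlgHom.map_det] at this
      exact this
    have hrel := four_cycle U U' W W' hU hW hdet
    let φ : MvPolynomial ((Fin (k + 1) ⊕ Fin (l + 1)) ⊕ (Fin (k + 1) × Fin (l + 1))) ℂ →ₐ[ℂ] A :=
      aeval (Sum.elim (Sum.elim (fun a => U a 0 * W' a 0)
        (fun b => U 0 0 * W' 0 0 * W 0 b * U' 0 b))
        (fun j => W j.1 j.2 * U 0 j.2 * W 0 0 * W' 0 j.2 * U' 0 0))
    have hφ : φ.comp (piE E) = q := by
      apply MvPolynomial.algHom_ext
      rintro ⟨⟨i, x, y⟩, h⟩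
      rcases i with a | b
      · obtain rfl := (hmem1 _ _ _).1 h
        have : U x 0 * W' x 0 * (W x y * U 0 y * W 0 0 * W' 0 y * U' 0 0) = U x y := by
          linear_combination (-(W' x 0 * W' 0 y * U' 0 0)) * hrel x y
            + U x y * (W 0 y * W' 0 y) * (U 0 0 * U' 0 0) * hW x 0
            + U x y * (U 0 0 * U' 0 0) * hW 0 y + U x y * hU 0 0
        simpa [φ, piE] using this
      · obtain rfl := (hmem2 _ _ _).1 h
        have : U 0 0 * W' 0 0 * W 0 y * U' 0 y * (W x y * U 0 y * W 0 0 * W' 0 y * U' 0 0)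
            = W x y := by
          linear_combination W x y * (W 0 0 * W' 0 0) * (W 0 y * W' 0 y) * (U 0 y * U' 0 y) * hU 0 0
            + W x y * (W 0 y * W' 0 y) * (U 0 y * U' 0 y) * hW 0 0
            + W x y * (U 0 y * U' 0 y) * hW 0 y + W x y * hU 0 y
        simpa [φ, piE] using this
    rw [← hφ, AlgHom.comp_apply]
    have hp' : piE E p = 0 := hp
    rw [hp', map_zero]
end

section
/- Let E ⊆ Fin v × Fin f and let s : E → ℝ satisfy s e > 0 for all e ∈ E. Suppose that for every cycle C in the bipartite graph G_E, with alternating edge sets C⁺ and C⁻, one has ∏_{e ∈ C⁺} s e = ∏_{e ∈ C⁻} s e. Then there exist r : Fin v → ℝ and c : Fin f → ℝ with r i > 0 and c j > 0 such that s(i,j) = r i * c j for all (i,j) ∈ E; that is, s is obtained from the all-ones point by positive row and column scalings. (This is the core of the forward direction of the theorem that graphic slack ideals force projective uniqueness.) -/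
/-- The bipartite simple graph on `Fin v ⊕ Fin f` whose edges are given by a support pattern
`E ⊆ Fin v × Fin f`: `Sum.inl i` is adjacent to `Sum.inr j` iff `(i,j) ∈ E`. -/
def bipGraph {v f : ℕ} (E : Set (Fin v × Fin f)) : SimpleGraph (Fin v ⊕ Fin f) :=
  SimpleGraph.fromRel fun x y => ∃ p ∈ E, x = Sum.inl p.1 ∧ y = Sum.inr p.2

open Classical in
/-- The weight of a dart of `G_E` traversed from left to right through the edge `(i,j) ∈ E`:
the value `s (i,j)`; darts traversed right to left get weight `1`. -/
noncomputable def fwdWeight {v f : ℕ} (E : Set (Fin v × Fin f)) (s : E → ℝ)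
    (d : (bipGraph E).Dart) : ℝ :=
  match d.toProd with
  | (Sum.inl i, Sum.inr j) => if h : (i, j) ∈ E then s ⟨(i, j), h⟩ else 1
  | _ => 1

open Classical in
/-- The weight of a dart of `G_E` traversed from right to left through the edge `(i,j) ∈ E`:
the value `s (i,j)`; darts traversed left to right get weight `1`. -/
noncomputable def bwdWeight {v f : ℕ} (E : Set (Fin v × Fin f)) (s : E → ℝ)
    (d : (bipGraph E).Dart) : ℝ :=
  match d.toProd with
  | (Sum.inr j, Sum.inl i) => if h : (i, j) ∈ E then s ⟨(i, j), h⟩ else 1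
  | _ => 1

namespace Aux13

variable {V : Type*} {G : SimpleGraph V}

lemma path_edge_sum (w : G.Dart → ℝ) (hs : ∀ d, w d.symm = - w d) {a b : V} (h : G.Adj a b)
    (q : G.Walk b a) (hq : q.IsPath) (he : s(a, b) ∈ q.edges) :
    w ⟨(a, b), h⟩ + (q.darts.map w).sum = 0 := by
  cases q with
  | nil => simp at he
  | cons h' q' =>
    rename_i x
    rw [SimpleGraph.Walk.cons_isPath_iff] at hq
    rw [SimpleGraph.Walk.edges_cons, List.mem_cons] at he
    rcases he with he | he
    · have hx : x = a := by
        rw [Sym2.eq_iff] at he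
        rcases he with ⟨h1, h2⟩ | ⟨h1, h2⟩
        · exact absurd h1 h.ne
        · exact h1.symm
      subst hx
      have hn : q' = SimpleGraph.Walk.nil := SimpleGraph.Walk.isPath_iff_eq_nil.1 hq.1
      subst hn
      have := hs ⟨(x, b), h⟩
      have h2 : (SimpleGraph.Dart.symm ⟨(x, b), h⟩ : G.Dart) = ⟨(b, x), h'⟩ := rfl
      rw [h2] at this
      simp [this]
    · exact absurd (SimpleGraph.Walk.snd_mem_support_of_mem_edges q' he) hq.2

lemma bypass_sum [DecidableEq V] (w : G.Dart → ℝ) (hs : ∀ d, w d.symm = - w d)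
    (hc : ∀ (x : V) (C : G.Walk x x), C.IsCycle → (C.darts.map w).sum = 0)
    {a b : V} (p : G.Walk a b) : (p.darts.map w).sum = (p.bypass.darts.map w).sum := by
  induction p with
  | nil => simp [SimpleGraph.Walk.bypass]
  | cons h p ih =>
    rename_i u x y
    simp only [SimpleGraph.Walk.bypass]
    split_ifs with hu
    · have hspec := congrArg (fun q => (q.darts.map w).sum) (p.bypass.take_spec hu)
      simp only [SimpleGraph.Walk.darts_append, List.map_append, List.sum_append] at hspec
      have hp : (p.bypass.takeUntil u hu).IsPath := p.bypass_isPath.takeUntil hu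
      have h0 : w ⟨(u, x), h⟩ + ((p.bypass.takeUntil u hu).darts.map w).sum = 0 := by
        by_cases he : s(u, x) ∈ (p.bypass.takeUntil u hu).edges
        · exact path_edge_sum w hs h _ hp he
        · have := hc u (.cons h (p.bypass.takeUntil u hu))
            ((SimpleGraph.Walk.cons_isCycle_iff _ h).2 ⟨hp, he⟩)
          simpa using this
      simp only [SimpleGraph.Walk.darts_cons, List.map_cons, List.sum_cons]
      linarith
    · simp [ih]

lemma closed_sum (w : G.Dart → ℝ) (hs : ∀ d, w d.symm = - w d)
    (hc : ∀ (x : V) (C : G.Walk x x), C.IsCycle → (C.darts.map w).sum = 0)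
    {a : V} (p : G.Walk a a) : (p.darts.map w).sum = 0 := by
  classical
  rw [bypass_sum w hs hc p, SimpleGraph.Walk.isPath_iff_eq_nil.1 p.bypass_isPath]
  simp

lemma reverse_sum (w : G.Dart → ℝ) (hs : ∀ d, w d.symm = - w d) {a b : V} (p : G.Walk a b) :
    (p.reverse.darts.map w).sum = - (p.darts.map w).sum := by
  induction p with
  | nil => simp
  | cons h p ih =>
    rename_i u x y
    have h2 : w ⟨(x, u), h.symm⟩ = - w ⟨(u, x), h⟩ := hs ⟨(u, x), h⟩
    simp only [SimpleGraph.Walk.reverse_cons, SimpleGraph.Walk.darts_append, List.map_append,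
      List.sum_append, ih, SimpleGraph.Walk.darts_cons, List.map_cons, List.sum_cons,
      SimpleGraph.Walk.darts_nil, List.map_nil, List.sum_nil, h2]
    ring

lemma exists_potential (w : G.Dart → ℝ) (hs : ∀ d, w d.symm = - w d)
    (hc : ∀ (x : V) (C : G.Walk x x), C.IsCycle → (C.darts.map w).sum = 0) :
    ∃ φ : V → ℝ, ∀ (a b : V) (h : G.Adj a b), φ b - φ a = w ⟨(a, b), h⟩ := by
  have hr : ∀ x, G.Reachable (G.connectedComponentMk x).out x := fun x =>
    SimpleGraph.ConnectedComponent.exact (Quot.out_eq _)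
  let P : ∀ x, G.Walk (G.connectedComponentMk x).out x := fun x => (hr x).some
  refine ⟨fun x => ((P x).darts.map w).sum, fun a b h => ?_⟩
  have hab : G.connectedComponentMk a = G.connectedComponentMk b :=
    SimpleGraph.ConnectedComponent.sound h.reachable
  have key : ∀ (c : V) (hcv : c = (G.connectedComponentMk b).out) (pa : G.Walk c a),
      ((P b).darts.map w).sum - (pa.darts.map w).sum = w ⟨(a, b), h⟩ := by
    intro c hcv pa
    subst hcv
    have := closed_sum w hs hc (pa.append (.cons h (P b).reverse))
    simp only [SimpleGraph.Walk.darts_append, List.map_append, List.sum_append,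
      SimpleGraph.Walk.darts_cons, List.map_cons, List.sum_cons, reverse_sum w hs] at this
    linarith
  exact key _ (by rw [hab]) (P a)

lemma log_sum {α : Type*} (F B : α → ℝ) (hF : ∀ a, 0 < F a) (hB : ∀ a, 0 < B a) (l : List α) :
    0 < (l.map F).prod ∧ 0 < (l.map B).prod ∧
    (l.map fun a => Real.log (F a) - Real.log (B a)).sum =
      Real.log (l.map F).prod - Real.log (l.map B).prod := by
  induction l with
  | nil => simp
  | cons a l ih =>
    obtain ⟨h1, h2, h3⟩ := ih
    refine ⟨?_, ?_, ?_⟩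
    · simpa using mul_pos (hF a) h1
    · simpa using mul_pos (hB a) h2
    · simp only [List.map_cons, List.sum_cons, List.prod_cons, h3]
      rw [Real.log_mul (hF a).ne' h1.ne', Real.log_mul (hB a).ne' h2.ne']
      ring

end Aux13

/-- If `s` is a positive point such that for every cycle `C` of the bipartite graph `G_E` the
product of `s` over the alternate edge set `C⁺` equals the product over `C⁻`, then `s` is a
positive row-and-column scaling of the all-ones point: `s (i,j) = r i * c j`. -/
theorem stmt13 (v f : ℕ) (E : Set (Fin v × Fin f)) (s : E → ℝ)
    (hpos : ∀ e, 0 < s e)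
    (hcyc : ∀ (x : Fin v ⊕ Fin f) (C : (bipGraph E).Walk x x), C.IsCycle →
      (C.darts.map (fwdWeight E s)).prod = (C.darts.map (bwdWeight E s)).prod) :
    ∃ (r : Fin v → ℝ) (c : Fin f → ℝ),
      (∀ i, 0 < r i) ∧ (∀ j, 0 < c j) ∧
      ∀ e : E, s e = r e.1.1 * c e.1.2 := by
  have hF : ∀ d, 0 < fwdWeight E s d := by
    intro d
    unfold fwdWeight
    split
    · split_ifs
      · exact hpos _
      · exact one_pos
    · exact one_pos
  have hB : ∀ d, 0 < bwdWeight E s d := by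
    intro d
    unfold bwdWeight
    split
    · split_ifs
      · exact hpos _
      · exact one_pos
    · exact one_pos
  have hFB : ∀ d : (bipGraph E).Dart, fwdWeight E s d.symm = bwdWeight E s d := by
    rintro ⟨⟨x | x, y | y⟩, h⟩ <;> rfl
  have hBF : ∀ d : (bipGraph E).Dart, bwdWeight E s d.symm = fwdWeight E s d := by
    rintro ⟨⟨x | x, y | y⟩, h⟩ <;> rfl
  obtain ⟨φ, hφ⟩ := Aux13.exists_potential
    (fun d => Real.log (fwdWeight E s d) - Real.log (bwdWeight E s d))
    (by intro d; simp only [hFB, hBF]; ring)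
    (by
      intro x C hC
      rw [(Aux13.log_sum _ _ hF hB C.darts).2.2, hcyc x C hC, sub_self])
  refine ⟨fun i => Real.exp (- φ (Sum.inl i)), fun j => Real.exp (φ (Sum.inr j)),
    fun i => Real.exp_pos _, fun j => Real.exp_pos _, ?_⟩
  rintro ⟨⟨i, j⟩, he⟩
  have hadj : (bipGraph E).Adj (Sum.inl i) (Sum.inr j) := by
    simp only [bipGraph, SimpleGraph.fromRel_adj]
    exact ⟨by simp, Or.inl ⟨(i, j), he, rfl, rfl⟩⟩
  have h1 := hφ _ _ hadj
  have h2 : fwdWeight E s ⟨(Sum.inl i, Sum.inr j), hadj⟩ = s ⟨(i, j), he⟩ := by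
    simp [fwdWeight, he]
  have h3 : bwdWeight E s ⟨(Sum.inl i, Sum.inr j), hadj⟩ = 1 := by
    simp [bwdWeight]
  simp only [h2, h3, Real.log_one, sub_zero] at h1
  simp only
  rw [← Real.exp_add, neg_add_eq_sub, h1, Real.exp_log (hpos _)]
end
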